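/- For the 3-state 3-symbol Turing machine M with transition table δ(A,0)=(1,R,B), δ(A,1)=(2,L,A), δ(A,2)=(1,L,C), δ(B,0)=(0,L,A), δ(B,1)=(2,R,B), δ(B,2)=(1,L,B), δ(C,0)=(1,R,H), δ(C,1)=(1,R,A), δ(C,2)=(1,R,C): started in state A on the all-blank tape the machine reaches a configuration C(1) in exactly 3 steps; and for every natural number k: from any configuration C(8k+1) it reaches C(14k+3) in exactly 112k²+116k+13 steps; from C(8k+2) it reaches C(14k+7) in exactly 112k²+144k+38 steps; from C(8k+3) it reaches C(14k+8) in exactly 112k²+172k+54 steps; from C(8k+4) it reaches C(14k+9) in exactly 112k²+200k+74 steps; from C(8k+5) it halts in exactly 112k²+228k+97 steps, the final tape reading left to right (all other cells blank): 1, the halted head scanning a cell containing 1, then 14k+9 cells containing 2; from C(8k+6) it reaches C(14k+14) in exactly 112k²+256k+139 steps; from C(8k+7) it reaches C(14k+15) in exactly 112k²+284k+169 steps; and from C(8k+8) it reaches C(14k+16) in exactly 112k²+312k+203 steps. -/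

import Mathlib

/-- Move direction of the tape head. -/
inductive Dir : Type
  | L
  | R

/-- The head displacement of a direction. -/
def Dir.move : Dir → ℤ
  | Dir.L => -1
  | Dir.R => 1

/-- A Turing machine with `n` states and `k` symbols, in Rado's busy beaver model.
States are `Fin n` (state `A` is `0`, `B` is `1`, ...), symbols are `Fin k` with `0`
the blank symbol. A transition yields the written symbol, the move direction and the
next state, where `none` denotes the halting state `H`. -/
abbrev Machine (n k : ℕ) : Type :=
  Fin n → Fin k → Fin k × Dir × Option (Fin n)

/-- A configuration: current state (`none` = halted), head position, tape. -/
structure Cfg (n k : ℕ) where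
  state : Option (Fin n)
  pos : ℤ
  tape : ℤ → Fin k

/-- One computation step (halted configurations are fixed). -/
def step {n k : ℕ} (M : Machine n k) (c : Cfg n k) : Cfg n k :=
  match c.state with
  | none => c
  | some q =>
      { state := (M q (c.tape c.pos)).2.2
        pos := c.pos + (M q (c.tape c.pos)).2.1.move
        tape := Function.update c.tape c.pos (M q (c.tape c.pos)).1 }

/-- The initial configuration: state `A`, head at cell `0`, all-blank tape. -/
def init (n k : ℕ) [NeZero k] : Cfg n k :=
  { state := if h : 0 < n then some ⟨0, h⟩ else none
    pos := 0
    tape := fun _ => 0 }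

/-- `HaltsIn M c t`: started from `c`, the machine `M` halts after exactly `t` steps. -/
def HaltsIn {n k : ℕ} (M : Machine n k) (c : Cfg n k) (t : ℕ) : Prop :=
  ((step M)^[t] c).state = none ∧ ∀ i < t, ((step M)^[i] c).state ≠ none

/-- The number of non-blank cells of a configuration. -/
noncomputable def sigmaCount {n k : ℕ} [NeZero k] (c : Cfg n k) : ℕ :=
  Set.ncard {i : ℤ | c.tape i ≠ 0}

/-- Terry and Shawn Ligocki's 3-state 3-symbol champion machine
(states `A,B,C` are `0,1,2`; `none` is the halting state `H`). -/
def M : Machine 3 3 :=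
  ![![(1, Dir.R, some 1), (2, Dir.L, some 0), (1, Dir.L, some 2)],
    ![(0, Dir.L, some 0), (2, Dir.R, some 1), (1, Dir.L, some 1)],
    ![(1, Dir.R, none), (1, Dir.R, some 0), (1, Dir.R, some 2)]]

/-- The configuration `C(n)` with head at cell `p`: state `A`, scanned cell blank,
the `n` cells immediately to the right of the head all contain `2`, all other cells blank. -/
def Cf (n : ℕ) (p : ℤ) : Cfg 3 3 :=
  { state := some 0
    pos := p
    tape := fun i => if p < i ∧ i ≤ p + n then 2 else 0 }

/-- A configuration seen from the head: the state, the cells to the left of the head (nearest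
first), and the scanned cell followed by the cells to its right. -/
structure HeadCfg where
  state : Option (Fin 3)
  left : Stream' (Fin 3)
  right : Stream' (Fin 3)

namespace HeadCfg

/-- One step of `M` relative to the head. -/
def next (c : HeadCfg) : HeadCfg :=
  match c.state with
  | none => c
  | some q =>
    match M q c.right.head with
    | (w, Dir.R, s) => ⟨s, Stream'.cons w c.left, c.right.tail⟩
    | (w, Dir.L, s) =>
      ⟨s, c.left.tail, Stream'.cons c.left.head (Stream'.cons w c.right.tail)⟩

/-- The absolute configuration with head at cell `p`. -/
def toCfg (c : HeadCfg) (p : ℤ) : Cfg 3 3 where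
  state := c.state
  pos := p
  tape i := if p ≤ i then c.right.get (i - p).toNat else c.left.get (p - 1 - i).toNat

theorem step_toCfg (c : HeadCfg) (p : ℤ) : ∃ q, step M (c.toCfg p) = c.next.toCfg q := by
  obtain ⟨_ | s, L, R⟩ := c
  · exact ⟨p, rfl⟩
  rcases h : M s (R.get 0) with ⟨w, _ | _, s'⟩
  · refine ⟨p - 1, ?_⟩
    simp only [step, toCfg, next, le_refl, if_true, sub_self, Int.toNat_zero, h, Dir.move]
    congr 1
    funext i
    rcases lt_trichotomy i p with hi | rfl | hi
    · rw [Function.update_of_ne hi.ne, if_neg (by omega)]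
      rcases eq_or_ne i (p - 1) with rfl | hi'
      · simp
      · rw [if_neg (by omega), show (p - 1 - i).toNat = (p - 1 - 1 - i).toNat + 1 by omega]
        rfl
    · rw [Function.update_self, if_pos (by omega), show (i - (i - 1)).toNat = 1 by omega]
      rfl
    · rw [Function.update_of_ne hi.ne', if_pos hi.le, if_pos (by omega),
        show (i - (p - 1)).toNat = (i - p - 1).toNat + 2 by omega,
        show (i - p).toNat = (i - p - 1).toNat + 1 by omega]
      rfl
  · refine ⟨p + 1, ?_⟩
    simp only [step, toCfg, next, le_refl, if_true, sub_self, Int.toNat_zero, h, Dir.move]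
    congr 1
    funext i
    rcases lt_trichotomy i p with hi | rfl | hi
    · rw [Function.update_of_ne hi.ne, if_neg (by omega), if_neg (by omega),
        show (p + 1 - 1 - i).toNat = (p - 1 - i).toNat + 1 by omega]
      rfl
    · rw [Function.update_self, if_neg (by omega), show (i + 1 - 1 - i).toNat = 0 by omega]
      rfl
    · rw [Function.update_of_ne hi.ne', if_pos hi.le, if_pos (by omega),
        show (i - p).toNat = (i - (p + 1)).toNat + 1 by omega]
      rfl

theorem iterate_step_toCfg (c : HeadCfg) (p : ℤ) (t : ℕ) :
    ∃ q, (step M)^[t] (c.toCfg p) = (next^[t] c).toCfg q := by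
  induction t with
  | zero => exact ⟨p, rfl⟩
  | succ t ih =>
    obtain ⟨q, hq⟩ := ih
    obtain ⟨q', hq'⟩ := step_toCfg (next^[t] c) q
    exact ⟨q', by rw [Function.iterate_succ_apply', hq, hq', Function.iterate_succ_apply']⟩

/-- `c` becomes `d` after exactly `t` steps. -/
def Reaches (t : ℕ) (c d : HeadCfg) : Prop :=
  next^[t] c = d

theorem Reaches.trans {s t u : ℕ} {c d e : HeadCfg} (h₁ : Reaches s c d) (h₂ : Reaches t d e)
    (h : u = t + s) : Reaches u c e := by
  subst h
  rw [Reaches, Function.iterate_add_apply, h₁, h₂]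

theorem Reaches.exists_iterate_step {t : ℕ} {c d : HeadCfg} (h : Reaches t c d) (p : ℤ) :
    ∃ q, (step M)^[t] (c.toCfg p) = d.toCfg q := by
  obtain ⟨q, hq⟩ := iterate_step_toCfg c p t
  exact ⟨q, hq.trans (by rw [h])⟩

/-- The blank half-tape. -/
def blank : Stream' (Fin 3) :=
  Stream'.const 0

/-- The half-tape `s` preceded by `n` copies of `a`. -/
def rep (n : ℕ) (a : Fin 3) (s : Stream' (Fin 3)) : Stream' (Fin 3) :=
  (Stream'.cons a)^[n] s

theorem rep_succ (n : ℕ) (a : Fin 3) (s : Stream' (Fin 3)) :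
    rep (n + 1) a s = Stream'.cons a (rep n a s) :=
  Function.iterate_succ_apply' _ _ _

theorem rep_cons (n : ℕ) (a : Fin 3) (s : Stream' (Fin 3)) :
    rep n a (Stream'.cons a s) = rep (n + 1) a s :=
  rfl

theorem rep_rep (m n : ℕ) (a : Fin 3) (s : Stream' (Fin 3)) :
    rep m a (rep n a s) = rep (m + n) a s :=
  (Function.iterate_add_apply _ _ _ _).symm

theorem cons_blank : Stream'.cons 0 blank = blank := by
  ext i : 1
  cases i <;> rfl

theorem get_rep_blank (n i : ℕ) (a : Fin 3) :
    (rep n a blank).get i = if i < n then a else 0 := by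
  induction n generalizing i with
  | zero => rfl
  | succ n ih =>
    rw [rep_succ]
    cases i with
    | zero => simp
    | succ i => simp [ih]

theorem toCfg_eq_Cf (n : ℕ) (p : ℤ) :
    toCfg ⟨some 0, blank, Stream'.cons 0 (rep n 2 blank)⟩ p = Cf n p := by
  simp only [toCfg, Cf]
  congr 1
  funext i
  rcases lt_trichotomy i p with hi | rfl | hi
  · rw [if_neg (by omega), if_neg (by omega)]
    rfl
  · simp
  · rw [if_pos hi.le, show (i - p).toNat = (i - p - 1).toNat + 1 by omega, Stream'.get_succ_cons,
      get_rep_blank]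
    congr 1
    apply propext
    omega

theorem reaches_right (n : ℕ) (L R : Stream' (Fin 3)) :
    Reaches n ⟨some 1, L, rep n 1 R⟩ ⟨some 1, rep n 2 L, R⟩ := by
  induction n generalizing L with
  | zero => rfl
  | succ n ih =>
    rw [rep_succ, ← rep_cons n 2]
    exact Reaches.trans (s := 1) rfl (ih _) rfl

theorem reaches_left (n : ℕ) (L R : Stream' (Fin 3)) :
    Reaches (n + 1) ⟨some 1, rep n 2 L, Stream'.cons 2 R⟩
      ⟨some 1, L.tail, Stream'.cons L.head (rep (n + 1) 1 R)⟩ := by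
  induction n generalizing R with
  | zero => rfl
  | succ n ih =>
    rw [rep_succ, ← rep_cons (n + 1) 1]
    exact Reaches.trans (s := 1) rfl (ih _) rfl

theorem reaches_zigzag (a : ℕ) (L R : Stream' (Fin 3)) :
    Reaches (2 * a + 3) ⟨some 1, rep a 2 (Stream'.cons 1 L), Stream'.cons 2 R⟩
      ⟨some 1, rep (a + 2) 2 L, R⟩ :=
  (reaches_left a (Stream'.cons 1 L) R).trans
    (by
      have h := reaches_right (a + 2) L R
      rwa [rep_succ (a + 1) 1] at h)
    (by ring)

theorem reaches_bounce (a : ℕ) (R : Stream' (Fin 3)) :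
    Reaches (2 * a + 15) ⟨some 1, rep a 2 blank, Stream'.cons 2 R⟩
      ⟨some 1, rep (a + 1) 2 (rep 3 1 blank), R⟩ := by
  have h₁ : Reaches 6 ⟨some 1, blank.tail, Stream'.cons blank.head (rep (a + 1) 1 R)⟩
      ⟨some 1, blank, Stream'.cons 1 (Stream'.cons 1 (Stream'.cons 0 (rep (a + 1) 1 R)))⟩ := rfl
  have h₂ : Reaches 7
      ⟨some 1, blank, Stream'.cons 1 (Stream'.cons 1 (Stream'.cons 0 (rep (a + 1) 1 R)))⟩
      ⟨some 1, rep 3 1 blank, rep (a + 1) 1 R⟩ := rfl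
  exact (reaches_left a blank R).trans ((h₁.trans h₂ rfl).trans (reaches_right (a + 1) _ R) rfl)
    (by ring)

theorem reaches_bounce_two (a : ℕ) (R : Stream' (Fin 3)) :
    Reaches (4 * a + 20) ⟨some 1, rep a 2 blank, rep 2 2 R⟩
      ⟨some 1, rep (a + 3) 2 (rep 2 1 blank), R⟩ :=
  (reaches_bounce a _).trans (reaches_zigzag (a + 1) _ _) (by ring)

theorem reaches_bounce_three (a : ℕ) (R : Stream' (Fin 3)) :
    Reaches (6 * a + 29) ⟨some 1, rep a 2 blank, rep 3 2 R⟩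
      ⟨some 1, rep (a + 5) 2 (rep 1 1 blank), R⟩ :=
  (reaches_bounce_two a _).trans (reaches_zigzag (a + 3) _ _) (by ring)

theorem reaches_bounce_four (a : ℕ) (R : Stream' (Fin 3)) :
    Reaches (8 * a + 42) ⟨some 1, rep a 2 blank, rep 4 2 R⟩
      ⟨some 1, rep (a + 7) 2 blank, R⟩ :=
  (reaches_bounce_three a _).trans (reaches_zigzag (a + 5) _ _) (by ring)

theorem reaches_bounce_cycles (k : ℕ) (R : Stream' (Fin 3)) :
    Reaches (112 * k ^ 2 + 60 * k) ⟨some 1, rep 2 2 blank, rep (8 * k) 2 R⟩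
      ⟨some 1, rep (14 * k + 2) 2 blank, R⟩ := by
  induction k generalizing R with
  | zero => rfl
  | succ k ih =>
    have h := ih (rep 4 2 (rep 4 2 R))
    rw [rep_rep, rep_rep] at h
    exact (h.trans (reaches_bounce_four _ _) rfl).trans (reaches_bounce_four _ _) (by ring)

/-- From `C(8k + r + 1)`, the machine reaches the last `r` cells of the block with only `2` to the
left of the head. -/
theorem reaches_absorb (k r : ℕ) :
    Reaches (112 * k ^ 2 + 60 * k + 4)
      ⟨some 0, blank, Stream'.cons 0 (rep (8 * k + r + 1) 2 blank)⟩
      ⟨some 1, rep (14 * k + 2) 2 blank, rep r 2 blank⟩ := by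
  have h : Reaches 4 ⟨some 0, blank, Stream'.cons 0 (rep (8 * k + r + 1) 2 blank)⟩
      ⟨some 1, rep 2 2 blank, rep (8 * k + r) 2 blank⟩ := by
    rw [rep_succ]
    rfl
  rw [← rep_rep (8 * k) r] at h
  exact h.trans (reaches_bounce_cycles k _) rfl

theorem reaches_return (n : ℕ) (L : Stream' (Fin 3)) :
    Reaches (8 * n + 9) ⟨some 1, rep (2 * n + 2) 2 L, blank⟩
      ⟨some 0, L.tail, Stream'.cons L.head (rep (2 * n + 3) 2 blank)⟩ := by
  induction n generalizing L with
  | zero =>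
    exact Eq.trans rfl
      (congrArg (fun s => HeadCfg.mk (some 0) L.tail (Stream'.cons L.head (rep 3 2 s))) cons_blank)
  | succ n ih =>
    refine (ih (Stream'.cons 2 (Stream'.cons 2 L))).trans (t := 8) ?_ (by ring)
    rw [show 2 * (n + 1) + 3 = 2 * n + 2 + 1 + 1 + 1 by ring, rep_succ (2 * n + 2),
      rep_succ (2 * n + 2 + 1 + 1), rep_succ (2 * n + 2 + 1), rep_succ (2 * n + 2)]
    rfl

theorem reaches_left_ones (b : ℕ) (R : Stream' (Fin 3)) :
    Reaches b ⟨some 0, (rep b 1 blank).tail, Stream'.cons (rep b 1 blank).head R⟩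
      ⟨some 0, blank, Stream'.cons 0 (rep b 2 R)⟩ := by
  induction b generalizing R with
  | zero => rfl
  | succ b ih =>
    rw [rep_succ b 1, ← rep_cons b 2]
    exact Reaches.trans (s := 1) rfl (ih _) rfl

theorem reaches_return_even (n b : ℕ) :
    Reaches (8 * n + 9 + b) ⟨some 1, rep (2 * n + 2) 2 (rep b 1 blank), blank⟩
      ⟨some 0, blank, Stream'.cons 0 (rep (b + (2 * n + 3)) 2 blank)⟩ := by
  rw [← rep_rep b]
  exact (reaches_return n _).trans (reaches_left_ones b _) (by ring)

theorem reaches_return_odd (n b : ℕ) :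
    Reaches (8 * n + 13 + b) ⟨some 1, rep (2 * n + 3) 2 (rep (b + 1) 1 blank), blank⟩
      ⟨some 0, blank, Stream'.cons 0 (rep (b + 2 + (2 * n + 3)) 2 blank)⟩ := by
  have h : Reaches 2
      ⟨some 0, rep (b + 1) 1 blank, Stream'.cons 2 (rep (2 * n + 3) 2 blank)⟩
      ⟨some 0, (rep (b + 2) 1 blank).tail,
        Stream'.cons (rep (b + 2) 1 blank).head (rep (2 * n + 3) 2 blank)⟩ := by
    rw [rep_succ (b + 1), rep_succ b]
    rfl
  rw [← rep_rep (b + 2)]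
  exact ((reaches_return n _).trans h rfl).trans (reaches_left_ones (b + 2) _) (by ring)

theorem reaches_return_blank (n : ℕ) :
    Reaches (8 * n + 10) ⟨some 1, rep (2 * n + 3) 2 blank, blank⟩
      ⟨some 2, blank, Stream'.cons 0 (Stream'.cons 1 (rep (2 * n + 3) 2 blank))⟩ :=
  (reaches_return n (Stream'.cons 2 blank)).trans (t := 1) rfl (by ring)

theorem Reaches.exists_Cf {t m n m' n' : ℕ}
    (h : Reaches t ⟨some 0, blank, Stream'.cons 0 (rep m 2 blank)⟩
      ⟨some 0, blank, Stream'.cons 0 (rep n 2 blank)⟩)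
    (p : ℤ) {t' : ℕ} (ht : t' = t) (hm : m' = m) (hn : n' = n) :
    ∃ q, (step M)^[t'] (Cf m' p) = Cf n' q := by
  subst ht hm hn
  obtain ⟨q, hq⟩ := h.exists_iterate_step p
  exact ⟨q, by rwa [toCfg_eq_Cf, toCfg_eq_Cf] at hq⟩

end HeadCfg

theorem iterate_step_state_eq_none_of_le {n k : ℕ} {M : Machine n k} {c : Cfg n k} {i j : ℕ}
    (hij : i ≤ j) (h : ((step M)^[i] c).state = none) : ((step M)^[j] c).state = none := by
  induction j, hij using Nat.le_induction with
  | base => exact h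
  | succ j _ ih => rwa [Function.iterate_succ_apply', step, ih]

theorem haltsIn_succ {n k : ℕ} {M : Machine n k} {c : Cfg n k} {t : ℕ}
    (h : ((step M)^[t + 1] c).state = none) (h' : ((step M)^[t] c).state ≠ none) :
    HaltsIn M c (t + 1) :=
  ⟨h, fun _ hi hn => h' (iterate_step_state_eq_none_of_le (Nat.lt_succ_iff.1 hi) hn)⟩

open HeadCfg

theorem reaches_before_halt (k : ℕ) :
    Reaches (112 * k ^ 2 + 228 * k + 96)
      ⟨some 0, blank, Stream'.cons 0 (rep (8 * k + 5) 2 blank)⟩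
      ⟨some 2, blank, Stream'.cons 0 (Stream'.cons 1 (rep (14 * k + 9) 2 blank))⟩ := by
  have h := reaches_return_blank (7 * k + 3)
  rw [show 2 * (7 * k + 3) + 3 = 14 * k + 2 + 7 by ring] at h
  exact ((reaches_absorb k 4).trans (reaches_bounce_four _ _) rfl).trans h (by ring)

theorem toCfg_halted (n : ℕ) (q : ℤ) :
    toCfg ⟨none, Stream'.cons 1 blank, Stream'.cons 1 (rep n 2 blank)⟩ (q + 1) =
      { state := none
        pos := q + 1
        tape := fun i =>
          if i = q ∨ i = q + 1 then 1
          else if q + 2 ≤ i ∧ i ≤ q + n + 1 then 2 else 0 } := by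
  simp only [toCfg]
  congr 1
  funext i
  rcases lt_trichotomy i q with hi | rfl | hi
  · rw [if_neg (by omega), if_neg (by omega), if_neg (by omega),
      show (q + 1 - 1 - i).toNat = (q - 1 - i).toNat + 1 by omega]
    rfl
  · simp
  · rcases eq_or_ne i (q + 1) with rfl | hi'
    · simp
    · rw [if_pos (by omega), if_neg (by omega),
        show (i - (q + 1)).toNat = (i - q - 2).toNat + 1 by omega, Stream'.get_succ_cons,
        get_rep_blank]
      congr 1
      apply propext
      omega

/-- Michel's analysis of the Ligockis' 3-state 3-symbol champion. -/
theorem ligocki_33_champion_analysis :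
    (∃ q : ℤ, (step M)^[3] (init 3 3) = Cf 1 q) ∧
    ∀ k : ℕ, ∀ p : ℤ,
      (∃ q : ℤ, (step M)^[112 * k ^ 2 + 116 * k + 13] (Cf (8 * k + 1) p) =
        Cf (14 * k + 3) q) ∧
      (∃ q : ℤ, (step M)^[112 * k ^ 2 + 144 * k + 38] (Cf (8 * k + 2) p) =
        Cf (14 * k + 7) q) ∧
      (∃ q : ℤ, (step M)^[112 * k ^ 2 + 172 * k + 54] (Cf (8 * k + 3) p) =
        Cf (14 * k + 8) q) ∧
      (∃ q : ℤ, (step M)^[112 * k ^ 2 + 200 * k + 74] (Cf (8 * k + 4) p) =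
        Cf (14 * k + 9) q) ∧
      (HaltsIn M (Cf (8 * k + 5) p) (112 * k ^ 2 + 228 * k + 97) ∧
        ∃ q : ℤ, (step M)^[112 * k ^ 2 + 228 * k + 97] (Cf (8 * k + 5) p) =
          { state := none
            pos := q + 1
            tape := fun i =>
              if i = q ∨ i = q + 1 then 1
              else if q + 2 ≤ i ∧ i ≤ q + 14 * k + 10 then 2 else 0 }) ∧
      (∃ q : ℤ, (step M)^[112 * k ^ 2 + 256 * k + 139] (Cf (8 * k + 6) p) =
        Cf (14 * k + 14) q) ∧
      (∃ q : ℤ, (step M)^[112 * k ^ 2 + 284 * k + 169] (Cf (8 * k + 7) p) =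
        Cf (14 * k + 15) q) ∧
      (∃ q : ℤ, (step M)^[112 * k ^ 2 + 312 * k + 203] (Cf (8 * k + 8) p) =
        Cf (14 * k + 16) q) := by
  refine ⟨?_, fun k p => ⟨?_, ?_, ?_, ?_, ?_, ?_, ?_, ?_⟩⟩
  · have h : Reaches 3 ⟨some 0, blank, Stream'.cons 0 (rep 0 2 blank)⟩
        ⟨some 0, blank, Stream'.cons 0 (rep 1 2 blank)⟩ :=
      Eq.trans rfl
        (congrArg (fun s => HeadCfg.mk (some 0) blank (Stream'.cons 0 (rep 1 2 s))) cons_blank)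
    obtain ⟨q, hq⟩ := h.exists_Cf 0 rfl rfl rfl
    refine ⟨q, hq ▸ congrArg _ ?_⟩
    simp only [init, Cf]
    congr 1
    funext i
    rw [if_neg (by push_cast; omega)]
  · have h := reaches_return_even (7 * k) 0
    rw [show 2 * (7 * k) + 2 = 14 * k + 2 by ring] at h
    exact ((reaches_absorb k 0).trans h rfl).exists_Cf p
      (by ring) (by ring) (by ring)
  · have h := reaches_return_odd (7 * k) 2
    rw [show 2 * (7 * k) + 3 = 14 * k + 2 + 1 by ring] at h
    exact (((reaches_absorb k 1).trans (reaches_bounce _ _) rfl).trans h rfl).exists_Cf p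
      (by ring) (by ring) (by ring)
  · have h := reaches_return_odd (7 * k + 1) 1
    rw [show 2 * (7 * k + 1) + 3 = 14 * k + 2 + 3 by ring] at h
    exact (((reaches_absorb k 2).trans (reaches_bounce_two _ _) rfl).trans h rfl).exists_Cf p
      (by ring) (by ring) (by ring)
  · have h := reaches_return_odd (7 * k + 2) 0
    rw [show 2 * (7 * k + 2) + 3 = 14 * k + 2 + 5 by ring] at h
    exact (((reaches_absorb k 3).trans (reaches_bounce_three _ _) rfl).trans h rfl).exists_Cf p
      (by ring) (by ring) (by ring)
  · have h := reaches_before_halt k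
    obtain ⟨q, hq⟩ := h.exists_iterate_step p
    obtain ⟨q', hq'⟩ := (h.trans (t := 1) rfl (Nat.add_comm _ _)).exists_iterate_step p
    rw [toCfg_eq_Cf] at hq hq'
    refine ⟨haltsIn_succ (congrArg Cfg.state hq')
      (by rw [hq]; exact Option.some_ne_none _), q' - 1, hq'.trans ?_⟩
    have h' := toCfg_halted (14 * k + 9) (q' - 1)
    rw [sub_add_cancel] at h'
    refine h'.trans ?_
    congr 1
    · ring
    · funext i
      push_cast
      ring_nf
  · have h := reaches_return_even (7 * k + 4) 3
    rw [show 2 * (7 * k + 4) + 2 = 14 * k + 2 + 7 + 1 by ring] at h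
    exact ((((reaches_absorb k 5).trans (reaches_bounce_four _ (rep 1 2 blank)) rfl).trans
      (reaches_bounce _ _) rfl).trans h rfl).exists_Cf p
      (by ring) (by ring) (by ring)
  · have h := reaches_return_even (7 * k + 5) 2
    rw [show 2 * (7 * k + 5) + 2 = 14 * k + 2 + 7 + 3 by ring] at h
    exact ((((reaches_absorb k 6).trans (reaches_bounce_four _ (rep 2 2 blank)) rfl).trans
      (reaches_bounce_two _ _) rfl).trans h rfl).exists_Cf p
      (by ring) (by ring) (by ring)
  · have h := reaches_return_even (7 * k + 6) 1
    rw [show 2 * (7 * k + 6) + 2 = 14 * k + 2 + 7 + 5 by ring] at h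
    exact ((((reaches_absorb k 7).trans (reaches_bounce_four _ (rep 3 2 blank)) rfl).trans
      (reaches_bounce_three _ _) rfl).trans h rfl).exists_Cf p
      (by ring) (by ring) (by ring)
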